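/- Let K be a CM number field with maximal real subfield F = K⁺ and G = Gal(K/F) generated by complex conjugation, and let S_F be a set of primes with #S_F = #S_K. Then (U_{K,S} : U_{F,S} · W_K) = (N U_{K,S} : U_{F,S}²) divides 2, and #H¹(G, U_{K,S}) divides 2, where W_K is the group of roots of unity in K. -/

import Mathlib

open NumberField IsDedekindDomain

variable (F K : Type*) [Field F] [NumberField F] [Field K] [NumberField K]
  [Algebra F K] [IsGalois F K]

/-- The set of primes of `K` lying above the primes in `SF`. -/
def SKset (SF : Finset (HeightOneSpectrum (𝓞 F))) : Set (HeightOneSpectrum (𝓞 K)) :=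
  {w | ∃ v ∈ SF, w.asIdeal.comap (algebraMap (𝓞 F) (𝓞 K)) = v.asIdeal}

/-- `#S_F`, counting the finite primes in `S_F` together with all infinite primes of `F`
(which `S_F` always contains). -/
noncomputable def nSF (SF : Finset (HeightOneSpectrum (𝓞 F))) : ℕ :=
  SF.card + Nat.card (InfinitePlace F)

/-- `#S_K`, counting the finite primes of `K` above `S_F` together with all infinite
primes of `K`. -/
noncomputable def nSK (SF : Finset (HeightOneSpectrum (𝓞 F))) : ℕ :=
  Nat.card (SKset F K SF) + Nat.card (InfinitePlace K)

/-- The action of `σ ∈ Gal(K/F)` on `Kˣ`. -/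
def sigmaU (σ : K ≃ₐ[F] K) : Kˣ →* Kˣ := Units.map σ.toAlgHom.toRingHom.toMonoidHom

/-- The norm map `u ↦ u · σ(u)` on `Kˣ` (for `Gal(K/F) = {1, σ}`). -/
def normU (σ : K ≃ₐ[F] K) : Kˣ →* Kˣ := MonoidHom.id Kˣ * sigmaU F K σ

/-- The map `u ↦ u / σ(u)` on `Kˣ`. -/
def oneSubU (σ : K ≃ₐ[F] K) : Kˣ →* Kˣ := MonoidHom.id Kˣ / sigmaU F K σ

/-- The subgroup of `Kˣ` fixed by the Galois group of `K/F`. -/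
def fixedU : Subgroup Kˣ where
  carrier := {u | ∀ τ : K ≃ₐ[F] K, sigmaU F K τ u = u}
  one_mem' := fun τ => map_one _
  mul_mem' := fun ha hb τ => by rw [map_mul, ha τ, hb τ]
  inv_mem' := fun ha τ => by rw [map_inv, ha τ]

/-- The group `U_{K,S}` of `S_K`-units of `K`. -/
noncomputable def UKS (SF : Finset (HeightOneSpectrum (𝓞 F))) : Subgroup Kˣ :=
  (SKset F K SF).unit K

/-- The group `U_{F,S}` of `S_F`-units of `F`, realized inside `Kˣ` as the Galois-fixed
`S_K`-units, via `U_{K,S}^G = U_{F,S}`. -/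
noncomputable def UFS (SF : Finset (HeightOneSpectrum (𝓞 F))) : Subgroup Kˣ :=
  UKS F K SF ⊓ fixedU F K

/-- The subgroup `U_{K,S}⁻` of norm-one `S_K`-units. -/
noncomputable def UKSminus (σ : K ≃ₐ[F] K) (SF : Finset (HeightOneSpectrum (𝓞 F))) :
    Subgroup Kˣ :=
  UKS F K SF ⊓ (normU F K σ).ker

/-- The norm subgroup `N U_{K,S}`. -/
noncomputable def NUKS (σ : K ≃ₐ[F] K) (SF : Finset (HeightOneSpectrum (𝓞 F))) :
    Subgroup Kˣ :=
  (UKS F K SF).map (normU F K σ)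

/-- `#H¹(G, U_{K,S})` for `G = Gal(K/F) = {1, σ}` of order `2`, computed as
`#({u ∈ U_{K,S} : N u = 1} / {u/σ(u) : u ∈ U_{K,S}})`. -/
noncomputable def H1U (σ : K ≃ₐ[F] K) (SF : Finset (HeightOneSpectrum (𝓞 F))) : ℕ :=
  Nat.card (UKSminus F K σ SF ⧸
    (((UKS F K SF).map (oneSubU F K σ)).subgroupOf (UKSminus F K σ SF)))

/-- `#Ĥ⁰(G, U_{K,S}) = (U_{F,S} : N U_{K,S})`. -/
noncomputable def H0U (σ : K ≃ₐ[F] K) (SF : Finset (HeightOneSpectrum (𝓞 F))) : ℕ :=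
  Nat.card (UFS F K SF ⧸ ((NUKS F K σ SF).subgroupOf (UFS F K SF)))

/-- The Herbrand quotient `h(G, U_{K,S})`. -/
noncomputable def herbrandU (σ : K ≃ₐ[F] K) (SF : Finset (HeightOneSpectrum (𝓞 F))) : ℚ :=
  (H0U F K σ SF : ℚ) / (H1U F K σ SF : ℚ)

section Valuation

variable {R L : Type*} [CommRing R] [IsDedekindDomain R] [Field L] [Algebra R L]
  [IsFractionRing R L]

theorem intValuation_le_of_comap_eq (e : R ≃+* R) {w w' : HeightOneSpectrum R}
    (h : w'.asIdeal = w.asIdeal.comap e) (r : R) :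
    w.intValuation (e r) ≤ w'.intValuation r := by
  rcases eq_or_ne r 0 with rfl | hr
  · simp
  · rw [w'.intValuation_if_neg hr, w.intValuation_le_pow_iff_mem]
    have hmem := (w'.intValuation_le_pow_iff_mem r _).1 (w'.intValuation_if_neg hr).le
    exact Ideal.le_comap_pow e _ (Ideal.pow_right_mono h.le _ hmem)

theorem intValuation_eq_of_comap_eq (e : R ≃+* R) {w w' : HeightOneSpectrum R}
    (h : w'.asIdeal = w.asIdeal.comap e) (r : R) :
    w.intValuation (e r) = w'.intValuation r := by
  refine (intValuation_le_of_comap_eq e h r).antisymm ?_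
  have h' : w.asIdeal = w'.asIdeal.comap e.symm := by
    ext x
    rw [h, Ideal.mem_comap, Ideal.mem_comap, RingEquiv.apply_symm_apply]
  simpa using intValuation_le_of_comap_eq e.symm h' (e r)

theorem valuation_eq_of_comap_eq (e : R ≃+* R) (f : L →+* L)
    (hf : ∀ r : R, f (algebraMap R L r) = algebraMap R L (e r)) {w w' : HeightOneSpectrum R}
    (h : w'.asIdeal = w.asIdeal.comap e) (x : L) :
    w.valuation L (f x) = w'.valuation L x := by
  obtain ⟨a, b, -, rfl⟩ := IsFractionRing.div_surjective (A := R) x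
  simp [hf, HeightOneSpectrum.valuation_of_algebraMap, intValuation_eq_of_comap_eq e h]

end Valuation

section Involution

variable {G : Type*} [CommGroup G]

/-- Let `s` be an endomorphism of a commutative group stabilizing a subgroup `U`, with fixed
subgroup `V` in `U`, and suppose that the elements of `U` of norm one form a subgroup `T` on
which `s` is inversion and whose squares have index dividing two. -/
theorem relIndex_involution (s : G →* G) {U V T : Subgroup G} (hTU : T ≤ U)
    (hs : ∀ u, s (s u) = u) (hU : ∀ u ∈ U, s u ∈ U) (hT : ∀ u ∈ U, u ∈ T ↔ u * s u = 1)
    (hV : ∀ u, u ∈ V ↔ u ∈ U ∧ s u = u)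
    (hsq : (T.map (powMonoidHom 2)).relIndex T ∣ 2) :
    (V ⊔ T).relIndex U =
      (V.map (powMonoidHom 2)).relIndex (U.map (MonoidHom.id G * s)) ∧
    (V ⊔ T).relIndex U ∣ 2 ∧ (U.map (MonoidHom.id G / s)).relIndex T ∣ 2 := by
  have hN : (V.map (powMonoidHom 2)).comap (MonoidHom.id G * s) ⊓ U = V ⊔ T := by
    ext u
    simp only [Subgroup.mem_inf, Subgroup.mem_comap, Subgroup.mem_map, Subgroup.mem_sup,
      powMonoidHom_apply, MonoidHom.mul_apply, MonoidHom.id_apply]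
    constructor
    · rintro ⟨⟨v, hv, hvu⟩, hu⟩
      obtain ⟨hvU, hsv⟩ := (hV v).1 hv
      refine ⟨v, hv, v⁻¹ * u, (hT _ (U.mul_mem (U.inv_mem hvU) hu)).2 ?_, by group⟩
      rw [map_mul, map_inv, hsv, mul_mul_mul_comm, ← hvu, pow_two]
      group
    · rintro ⟨v, hv, t, ht, rfl⟩
      obtain ⟨hvU, hsv⟩ := (hV v).1 hv
      refine ⟨⟨v, hv, ?_⟩, U.mul_mem hvU (hTU ht)⟩
      rw [map_mul, hsv, mul_mul_mul_comm, (hT t (hTU ht)).1 ht, mul_one, pow_two]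
  have hinv : ∀ t ∈ T, s t = t⁻¹ := fun t ht =>
    (inv_eq_of_mul_eq_one_right ((hT t (hTU ht)).1 ht)).symm
  have hD : (T.map (powMonoidHom 2)).comap (MonoidHom.id G / s) ⊓ U = V ⊔ T := by
    ext u
    simp only [Subgroup.mem_inf, Subgroup.mem_comap, Subgroup.mem_map, Subgroup.mem_sup,
      powMonoidHom_apply, MonoidHom.div_apply, MonoidHom.id_apply]
    constructor
    · rintro ⟨⟨t, ht, htu⟩, hu⟩
      refine ⟨u * t⁻¹, (hV _).2 ⟨U.mul_mem hu (U.inv_mem (hTU ht)), ?_⟩, t, ht, by group⟩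
      have hsu : s u = u / t ^ 2 := by rw [htu]; simp
      rw [map_mul, map_inv, hinv t ht, hsu, pow_two, div_eq_mul_inv, mul_inv]
      group
    · rintro ⟨v, hv, t, ht, rfl⟩
      obtain ⟨hvU, hsv⟩ := (hV v).1 hv
      refine ⟨⟨t, ht, ?_⟩, U.mul_mem hvU (hTU ht)⟩
      rw [map_mul, hsv, hinv t ht, mul_div_mul_left_eq_div, div_inv_eq_mul, pow_two]
  have hle : T.map (powMonoidHom 2) ≤ U.map (MonoidHom.id G / s) := by
    rintro _ ⟨t, ht, rfl⟩
    refine ⟨t, hTU ht, ?_⟩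
    simp [hinv t ht, pow_two]
  have hle' : U.map (MonoidHom.id G / s) ≤ T := by
    rintro _ ⟨u, hu, rfl⟩
    refine (hT _ (U.div_mem hu (hU u hu))).2 ?_
    simp [hs]
  have hmul := Subgroup.relIndex_mul_relIndex _ _ _ hle hle'
  refine ⟨?_, ?_, (Dvd.intro_left _ hmul).trans hsq⟩
  · rw [← hN, Subgroup.inf_relIndex_right, Subgroup.relIndex_comap]
  · rw [← hD, Subgroup.inf_relIndex_right, Subgroup.relIndex_comap]
    exact (Dvd.intro _ hmul).trans hsq

end Involution

section NumberField

variable {L : Type*} [Field L]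

theorem isIntegral_of_mem_torsion {u : Lˣ} (hu : u ∈ CommGroup.torsion Lˣ) :
    IsIntegral ℤ (u : L) := by
  obtain ⟨n, hn, h⟩ := isOfFinOrder_iff_pow_eq_one.1 ((CommGroup.mem_torsion _).1 hu)
  refine IsIntegral.of_pow hn ?_
  rw [← Units.val_pow_eq_pow_val, h]
  exact isIntegral_one

theorem valuation_eq_one_of_mem_torsion [NumberField L] {u : Lˣ}
    (hu : u ∈ CommGroup.torsion Lˣ) (w : HeightOneSpectrum (𝓞 L)) :
    w.valuation L (u : L) = 1 := by
  obtain ⟨n, hn, h⟩ := isOfFinOrder_iff_pow_eq_one.1 ((CommGroup.mem_torsion _).1 hu)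
  rw [← pow_eq_one_iff_of_nonneg zero_le hn.ne', ← map_pow, ← Units.val_pow_eq_pow_val, h]
  simp

theorem relIndex_torsion_sq_dvd_two [NumberField L] :
    ((CommGroup.torsion Lˣ).map (powMonoidHom 2)).relIndex (CommGroup.torsion Lˣ) ∣ 2 := by
  let f : (𝓞 L)ˣ →* Lˣ := Units.map (algebraMap (𝓞 L) L).toMonoidHom
  have hf : ∀ b ∈ CommGroup.torsion Lˣ, ∃ c ∈ Units.torsion L, f c = b := by
    intro b hb
    let c : (𝓞 L)ˣ := ⟨⟨b, isIntegral_of_mem_torsion hb⟩,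
      ⟨(b⁻¹ : Lˣ), isIntegral_of_mem_torsion (inv_mem hb)⟩,
      RingOfIntegers.ext b.mul_inv, RingOfIntegers.ext b.inv_mul⟩
    have hc : f c = b := Units.ext rfl
    refine ⟨c, ?_, hc⟩
    have hinj : Function.Injective f :=
      Units.map_injective (FaithfulSMul.algebraMap_injective (𝓞 L) L)
    exact (CommGroup.mem_torsion _).2 ((hinj.isOfFinOrder_iff).1 (hc ▸ hb))
  obtain ⟨g, hg⟩ := IsCyclic.exists_generator (α := Units.torsion L)
  have hgT : f g ∈ CommGroup.torsion Lˣ :=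
    (CommGroup.mem_torsion _).2 (f.isOfFinOrder ((CommGroup.mem_torsion _).1 g.2))
  rw [Subgroup.relIndex_dvd_two_iff]
  refine ⟨f g, hgT, fun b hb => ?_⟩
  obtain ⟨c, hc, rfl⟩ := hf b hb
  obtain ⟨k, hk⟩ := Subgroup.mem_zpowers_iff.1 (hg ⟨c, hc⟩)
  have hk' : f c = f g ^ k := by
    rw [← map_zpow, ← Subgroup.coe_zpow, hk]
  rw [hk']
  rcases Int.even_or_odd' k with ⟨m, rfl | rfl⟩
  · refine Or.inr ⟨f g ^ m, zpow_mem hgT m, ?_⟩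
    rw [powMonoidHom_apply, ← zpow_natCast, ← zpow_mul, mul_comm, Nat.cast_ofNat]
  · refine Or.inl ⟨f g ^ (m + 1), zpow_mem hgT _, ?_⟩
    rw [powMonoidHom_apply, ← zpow_natCast, ← zpow_mul, ← zpow_add_one]
    congr 1
    push_cast
    ring

theorem mem_torsion_of_valuation_eq_one [NumberField L] {u : Lˣ}
    (hval : ∀ w : HeightOneSpectrum (𝓞 L), w.valuation L (u : L) = 1)
    (hnorm : ∀ φ : L →+* ℂ, ‖φ u‖ = 1) : u ∈ CommGroup.torsion Lˣ := by
  obtain ⟨r, hr⟩ := HeightOneSpectrum.mem_integers_of_valuation_le_one (R := 𝓞 L) L (u : L)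
    fun w => (hval w).le
  have hint : IsIntegral ℤ (u : L) := hr ▸ r.2
  obtain ⟨n, hn, h⟩ := Embeddings.pow_eq_one_of_norm_eq_one L ℂ hint hnorm
  exact (CommGroup.mem_torsion _).2
    (isOfFinOrder_iff_pow_eq_one.2 ⟨n, hn, Units.ext (by simpa using h)⟩)

end NumberField

section CM

set_option linter.unusedSectionVars false

variable {F K}

theorem card_infinitePlace_eq_of_cm (hd : Module.finrank F K = 2)
    (htr : ∀ v : InfinitePlace F, v.IsReal) (htc : ∀ w : InfinitePlace K, w.IsComplex) :
    Nat.card (InfinitePlace F) = Nat.card (InfinitePlace K) := by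
  have : IsTotallyReal F := ⟨htr⟩
  have : IsTotallyComplex K := ⟨htc⟩
  have h := Module.finrank_mul_finrank ℚ F K
  rw [hd, IsTotallyReal.finrank, IsTotallyComplex.finrank] at h
  rw [Nat.card_eq_fintype_card, Nat.card_eq_fintype_card,
    InfinitePlace.card_eq_nrRealPlaces_add_nrComplexPlaces,
    InfinitePlace.card_eq_nrRealPlaces_add_nrComplexPlaces,
    IsTotallyComplex.nrRealPlaces_eq_zero K, IsTotallyReal.nrComplexPlaces_eq_zero F]
  omega

theorem eq_one_or_eq_of_finrank_eq_two (hd : Module.finrank F K = 2) {σ : K ≃ₐ[F] K}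
    (hσ : σ ≠ 1) (τ : K ≃ₐ[F] K) : τ = 1 ∨ τ = σ := by
  have hc : Nat.card (K ≃ₐ[F] K) = 2 := (IsGalois.card_aut_eq_finrank F K).trans hd
  obtain ⟨x, -, hx⟩ := (Nat.card_eq_two_iff' (1 : K ≃ₐ[F] K)).1 hc
  by_cases hτ : τ = 1
  · exact Or.inl hτ
  · exact Or.inr ((hx τ hτ).trans (hx σ hσ).symm)

theorem isConj_of_cm (hd : Module.finrank F K = 2)
    (htr : ∀ v : InfinitePlace F, v.IsReal) (htc : ∀ w : InfinitePlace K, w.IsComplex)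
    {σ : K ≃ₐ[F] K} (hσ : σ ≠ 1) (φ : K →+* ℂ) : ComplexEmbedding.IsConj φ σ := by
  obtain ⟨τ, hτ⟩ := InfinitePlace.exists_isConj_of_isRamified (k := F) (φ := φ)
    (InfinitePlace.isRamified_iff.2 ⟨htc _, htr _⟩)
  have hτ1 : τ ≠ 1 := (ComplexEmbedding.isConj_ne_one_iff hτ).2
    (InfinitePlace.isComplex_mk_iff.1 (htc (InfinitePlace.mk φ)))
  rcases eq_one_or_eq_of_finrank_eq_two hd hσ τ with h | h
  · exact absurd h hτ1
  · exact h ▸ hτ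

theorem map_mul_eq_norm_sq {φ : K →+* ℂ} {σ : K ≃ₐ[F] K} (h : ComplexEmbedding.IsConj φ σ)
    (x : K) : φ (x * σ x) = ((‖φ x‖ ^ 2 : ℝ) : ℂ) := by
  rw [map_mul, h.eq]
  simpa using Complex.mul_conj' (φ x)

theorem injOn_comap_SKset {SF : Finset (HeightOneSpectrum (𝓞 F))}
    (hcard : SF.card = Nat.card (SKset F K SF)) {w w' : HeightOneSpectrum (𝓞 K)}
    (hw : w ∈ SKset F K SF)
    (h : w.asIdeal.comap (algebraMap (𝓞 F) (𝓞 K)) =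
      w'.asIdeal.comap (algebraMap (𝓞 F) (𝓞 K))) : w = w' := by
  choose f hf hfw using fun w : SKset F K SF => w.2
  let g : SKset F K SF → SF := fun w => ⟨f w, hf w⟩
  have hg : Function.Surjective g := by
    rintro ⟨v, hv⟩
    obtain ⟨Q, hQ, hQv⟩ := Ideal.exists_ideal_over_prime_of_isIntegral_of_isDomain
      (S := 𝓞 K) v.asIdeal (by
        rw [(RingHom.injective_iff_ker_eq_bot _).1
          (FaithfulSMul.algebraMap_injective (𝓞 F) (𝓞 K))]
        exact bot_le)
    have hQ0 : Q ≠ ⊥ := by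
      rintro rfl
      refine v.ne_bot (hQv.symm.trans ?_)
      exact (RingHom.injective_iff_ker_eq_bot _).1
        (FaithfulSMul.algebraMap_injective (𝓞 F) (𝓞 K))
    refine ⟨⟨⟨Q, hQ, hQ0⟩, v, hv, hQv⟩, Subtype.ext (HeightOneSpectrum.ext ?_)⟩
    exact (hfw _).symm.trans hQv
  have hne : Nat.card (SKset F K SF) ≠ 0 := by
    rw [← hcard]
    exact Finset.card_ne_zero_of_mem (hf ⟨w, hw⟩)
  have : Finite (SKset F K SF) := Nat.finite_of_card_ne_zero hne
  have hinj : Function.Injective g :=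
    (hg.bijective_of_nat_card_le (by rw [← hcard]; simp)).injective
  have hw' : w' ∈ SKset F K SF := by
    obtain ⟨v, hv, hwv⟩ := hw
    exact ⟨v, hv, h ▸ hwv⟩
  have hgw : g ⟨w, hw⟩ = g ⟨w', hw'⟩ :=
    Subtype.ext (HeightOneSpectrum.ext ((hfw ⟨w, hw⟩).symm.trans (h.trans (hfw ⟨w', hw'⟩))))
  exact congrArg Subtype.val (hinj hgw)

/-- The conjugate of a prime of `K` under `σ ∈ Gal(K/F)`. -/
noncomputable def conjPrime (σ : K ≃ₐ[F] K) (w : HeightOneSpectrum (𝓞 K)) :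
    HeightOneSpectrum (𝓞 K) :=
  w.comap (RingOfIntegers.mapRingEquiv σ.toRingEquiv : 𝓞 K →+* 𝓞 K)
    (RingOfIntegers.mapRingEquiv σ.toRingEquiv).surjective

theorem comap_conjPrime (σ : K ≃ₐ[F] K) (w : HeightOneSpectrum (𝓞 K)) :
    (conjPrime σ w).asIdeal.comap (algebraMap (𝓞 F) (𝓞 K)) =
      w.asIdeal.comap (algebraMap (𝓞 F) (𝓞 K)) := by
  have h : (RingOfIntegers.mapRingEquiv σ.toRingEquiv : 𝓞 K →+* 𝓞 K).comp
      (algebraMap (𝓞 F) (𝓞 K)) = algebraMap (𝓞 F) (𝓞 K) :=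
    RingHom.ext fun x => RingOfIntegers.ext (σ.commutes (x : F))
  exact (Ideal.comap_comap _ _).trans (by rw [h])

theorem valuation_conjPrime (σ : K ≃ₐ[F] K) (w : HeightOneSpectrum (𝓞 K)) (x : K) :
    w.valuation K (σ x) = (conjPrime σ w).valuation K x :=
  valuation_eq_of_comap_eq (RingOfIntegers.mapRingEquiv σ.toRingEquiv) (σ : K →+* K)
    (fun _ => rfl) rfl x

theorem sigmaU_mem_UKS (σ : K ≃ₐ[F] K) {SF : Finset (HeightOneSpectrum (𝓞 F))} {u : Kˣ}
    (hu : u ∈ UKS F K SF) : sigmaU F K σ u ∈ UKS F K SF := by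
  intro w hw
  refine (valuation_conjPrime σ w u).trans (hu _ fun hw' => hw ?_)
  obtain ⟨v, hv, h⟩ := hw'
  exact ⟨v, hv, (comap_conjPrime σ w).symm.trans h⟩

theorem torsion_le_UKS (SF : Finset (HeightOneSpectrum (𝓞 F))) :
    CommGroup.torsion Kˣ ≤ UKS F K SF :=
  fun _ hu w _ => valuation_eq_one_of_mem_torsion hu w

theorem mem_torsion_iff_norm_eq_one {σ : K ≃ₐ[F] K}
    (hσ : ∀ φ : K →+* ℂ, ComplexEmbedding.IsConj φ σ)
    {SF : Finset (HeightOneSpectrum (𝓞 F))} (hcard : SF.card = Nat.card (SKset F K SF))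
    {u : Kˣ} (hu : u ∈ UKS F K SF) :
    u ∈ CommGroup.torsion Kˣ ↔ u * sigmaU F K σ u = 1 := by
  constructor
  · intro ht
    obtain ⟨n, hn, h⟩ := isOfFinOrder_iff_pow_eq_one.1 ((CommGroup.mem_torsion _).1 ht)
    have φ : K →+* ℂ := Classical.choice inferInstance
    have hφ : ‖φ u‖ = 1 := by
      refine (pow_eq_one_iff_of_nonneg (norm_nonneg _) hn.ne').1 ?_
      rw [← norm_pow, ← map_pow, ← Units.val_pow_eq_pow_val, h]
      simp
    refine Units.ext (φ.injective ?_)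
    exact (map_mul_eq_norm_sq (hσ φ) u).trans (by simp [hφ])
  · intro h
    have h' : (u : K) * σ u = 1 := congrArg Units.val h
    refine mem_torsion_of_valuation_eq_one (fun w => ?_) fun φ => ?_
    · by_cases hw : w ∈ SKset F K SF
      · have hval := congrArg (w.valuation K) h'
        rw [map_mul, valuation_conjPrime,
          ← injOn_comap_SKset hcard hw (comap_conjPrime σ w).symm, map_one, ← pow_two] at hval
        exact (pow_eq_one_iff_of_nonneg zero_le two_ne_zero).1 hval
      · exact hu w hw
    · have hn := map_mul_eq_norm_sq (hσ φ) u
      rw [h', map_one] at hn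
      have hn' : ‖φ u‖ ^ 2 = 1 := by exact_mod_cast hn.symm
      exact (pow_eq_one_iff_of_nonneg (norm_nonneg _) two_ne_zero).1 hn'

end CM

/-- Let `K` be a CM number field with maximal real subfield `F = K⁺`,
`G = Gal(K/F) = {1, σ}` with `σ` complex conjugation, and suppose `#S_F = #S_K`.  Then
`(U_{K,S} : U_{F,S}·W_K) = (N U_{K,S} : U_{F,S}²)` divides `2`, and `#H¹(G, U_{K,S})`
divides `2`, where `W_K` is the group of roots of unity of `K`. -/
theorem cm_index_sunits_eq_and_dvd_two
    (hd : Module.finrank F K = 2)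
    (htr : ∀ v : InfinitePlace F, v.IsReal) (htc : ∀ w : InfinitePlace K, w.IsComplex)
    (σ : K ≃ₐ[F] K) (hσ : σ ≠ AlgEquiv.refl)
    (SF : Finset (HeightOneSpectrum (𝓞 F))) (hcard : nSF F SF = nSK F K SF) :
    Nat.card (UKS F K SF ⧸
        ((UFS F K SF ⊔ (CommGroup.torsion Kˣ ⊓ UKS F K SF)).subgroupOf (UKS F K SF))) =
      Nat.card (NUKS F K σ SF ⧸
        (((UFS F K SF).map (powMonoidHom 2)).subgroupOf (NUKS F K σ SF))) ∧
    Nat.card (UKS F K SF ⧸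
        ((UFS F K SF ⊔ (CommGroup.torsion Kˣ ⊓ UKS F K SF)).subgroupOf (UKS F K SF))) ∣ 2 ∧
    H1U F K σ SF ∣ 2 := by
  have hconj := isConj_of_cm hd htr htc hσ
  have hc : SF.card = Nat.card (SKset F K SF) := by
    have h := card_infinitePlace_eq_of_cm hd htr htc
    unfold nSF nSK at hcard
    omega
  have hT : ∀ u ∈ UKS F K SF, u ∈ CommGroup.torsion Kˣ ↔ u * sigmaU F K σ u = 1 :=
    fun u hu => mem_torsion_iff_norm_eq_one hconj hc hu
  have hss : ∀ u, sigmaU F K σ (sigmaU F K σ u) = u := fun u =>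
    Units.ext (ComplexEmbedding.isConj_apply_apply (hconj (Classical.choice inferInstance)) u)
  have hV : ∀ u, u ∈ UFS F K SF ↔ u ∈ UKS F K SF ∧ sigmaU F K σ u = u := by
    refine fun u => and_congr_right fun _ => ⟨fun h => h σ, fun h τ => ?_⟩
    rcases eq_one_or_eq_of_finrank_eq_two hd hσ τ with rfl | rfl
    · exact Units.ext rfl
    · exact h
  have hminus : UKSminus F K σ SF = CommGroup.torsion Kˣ := by
    ext u
    exact ⟨fun h => (hT u h.1).2 h.2, fun h => ⟨torsion_le_UKS SF h,
      (hT u (torsion_le_UKS SF h)).1 h⟩⟩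
  rw [H1U, hminus, inf_eq_left.2 (torsion_le_UKS SF)]
  exact relIndex_involution (sigmaU F K σ) (torsion_le_UKS SF) hss
    (fun u hu => sigmaU_mem_UKS σ hu) hT hV relIndex_torsion_sq_dvd_two
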